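/- arXiv:2311.18779 — 7 statements merged into one kernel-verified Lean document; each statement's English description precedes it below -/
import Mathlib

section
/- Let E be a finite-dimensional complex inner product space, let R be a Kähler curvature-type tensor on E, and let e₁ ∈ E be a unit vector which minimizes the holomorphic sectional curvature of R, i.e. R(e₁,e₁,e₁,e₁) ≤ R(V,V,V,V) for every unit vector V ∈ E. Then for every unit vector W ∈ E one has 2·R(e₁,e₁,W,W) ≥ (1 + |⟨W,e₁⟩|²)·R(e₁,e₁,e₁,e₁), where both sides are real numbers. -/
open scoped ComplexConjugate InnerProductSpace

/-- A Kähler curvature-type tensor on a complex inner product space `E`: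
a map `R : E × E × E × E → ℂ` which is ℂ-linear in the 1st and 3rd arguments,
conjugate-ℂ-linear in the 2nd and 4th arguments, and satisfies the Kähler
symmetries `R(X,Y,Z,W) = R(Z,Y,X,W)`, `R(X,Y,Z,W) = R(X,W,Z,Y)` and
`R(X,Y,Z,W) = conj (R(Y,X,W,Z))`.  It models the curvature tensor of a
Kähler metric at a point, `R X Y Z W` corresponding to `R(X,Ȳ,Z,W̄)`. -/
structure KahlerCurvatureTensor (E : Type*) [NormedAddCommGroup E]
    [InnerProductSpace ℂ E] where
  R : E → E → E → E → ℂ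
  add_fst : ∀ X X' Y Z W, R (X + X') Y Z W = R X Y Z W + R X' Y Z W
  smul_fst : ∀ (a : ℂ) X Y Z W, R (a • X) Y Z W = a * R X Y Z W
  add_snd : ∀ X Y Y' Z W, R X (Y + Y') Z W = R X Y Z W + R X Y' Z W
  smul_snd : ∀ (a : ℂ) X Y Z W, R X (a • Y) Z W = conj a * R X Y Z W
  add_trd : ∀ X Y Z Z' W, R X Y (Z + Z') W = R X Y Z W + R X Y Z' W
  smul_trd : ∀ (a : ℂ) X Y Z W, R X Y (a • Z) W = a * R X Y Z W
  add_fth : ∀ X Y Z W W', R X Y Z (W + W') = R X Y Z W + R X Y Z W'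
  smul_fth : ∀ (a : ℂ) X Y Z W, R X Y Z (a • W) = conj a * R X Y Z W
  sym_fst_trd : ∀ X Y Z W, R X Y Z W = R Z Y X W
  sym_snd_fth : ∀ X Y Z W, R X Y Z W = R X W Z Y
  conj_sym : ∀ X Y Z W, R X Y Z W = conj (R Y X W Z)

namespace KahlerCurvatureTensor

variable {E : Type*} [NormedAddCommGroup E] [InnerProductSpace ℂ E]

/-- Averaging `R(V,V,V,V)` over `V = e + aw` with `a⁴ = 1` isolates the mixed term. -/
theorem sum_fourth_roots (T : KahlerCurvatureTensor E) (e w : E) :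
    T.R (e + (1 : ℂ) • w) (e + (1 : ℂ) • w) (e + (1 : ℂ) • w) (e + (1 : ℂ) • w)
      + T.R (e + (-1 : ℂ) • w) (e + (-1 : ℂ) • w) (e + (-1 : ℂ) • w) (e + (-1 : ℂ) • w)
      + T.R (e + Complex.I • w) (e + Complex.I • w) (e + Complex.I • w) (e + Complex.I • w)
      + T.R (e + (-Complex.I) • w) (e + (-Complex.I) • w) (e + (-Complex.I) • w)
          (e + (-Complex.I) • w)
      = 4 * T.R e e e e + 16 * T.R e e w w + 4 * T.R w w w w := by
  have h₁ : T.R w w e e = T.R e e w w := by rw [T.sym_fst_trd, T.sym_snd_fth]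
  have h₂ : T.R w e e w = T.R e e w w := T.sym_fst_trd ..
  have h₃ : T.R e w w e = T.R e e w w := T.sym_snd_fth ..
  have hI := Complex.I_sq
  have hI4 := Complex.I_pow_four
  simp only [T.add_fst, T.add_snd, T.add_trd, T.add_fth, T.smul_fst, T.smul_snd, T.smul_trd,
    T.smul_fth, map_one, map_neg, Complex.conj_I, h₁, h₂, h₃]
  ring_nf
  simp only [hI, hI4]
  ring

theorem holomorphic_re_real_smul (T : KahlerCurvatureTensor E) (t : ℝ) (V : E) :
    (T.R ((t : ℂ) • V) ((t : ℂ) • V) ((t : ℂ) • V) ((t : ℂ) • V)).re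
      = t ^ 4 * (T.R V V V V).re := by
  simp only [T.smul_fst, T.smul_snd, T.smul_trd, T.smul_fth, Complex.conj_ofReal,
    Complex.re_ofReal_mul]
  ring

/-- A Kähler curvature-type tensor with nonnegative holomorphic sectional curvature, vanishing
at `e`, has nonnegative bisectional curvature in the direction `e`. -/
theorem bisectional_nonneg_of_eq_zero (T : KahlerCurvatureTensor E)
    (hT : ∀ V, 0 ≤ (T.R V V V V).re) (e : E) (he : (T.R e e e e).re = 0) (w : E) :
    0 ≤ (T.R e e w w).re := by
  have key : ∀ t : ℝ, 0 < t → 0 ≤ 4 * (T.R e e w w).re + t ^ 2 * (T.R w w w w).re := by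
    intro t ht
    have h := congrArg Complex.re (T.sum_fourth_roots e ((t : ℂ) • w))
    have h₁ : (T.R e e ((t : ℂ) • w) ((t : ℂ) • w)).re = t ^ 2 * (T.R e e w w).re := by
      simp only [T.smul_trd, T.smul_fth, Complex.conj_ofReal, Complex.re_ofReal_mul]
      ring
    have h4 : ((4 : ℂ) * T.R e e e e).re = 0 := by simp [he]
    have h5 : ∀ z : ℂ, ((16 : ℂ) * z).re = 16 * z.re := fun z => by simp
    have h6 : ∀ z : ℂ, ((4 : ℂ) * z).re = 4 * z.re := fun z => by simp
    rw [Complex.add_re, Complex.add_re, Complex.add_re, Complex.add_re, Complex.add_re,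
      h4, h5, h6, h₁, T.holomorphic_re_real_smul t w] at h
    have p₁ := hT (e + (1 : ℂ) • (t : ℂ) • w)
    have p₂ := hT (e + (-1 : ℂ) • (t : ℂ) • w)
    have p₃ := hT (e + Complex.I • (t : ℂ) • w)
    have p₄ := hT (e + (-Complex.I) • (t : ℂ) • w)
    have : 0 ≤ t ^ 2 * (4 * (T.R e e w w).re + t ^ 2 * (T.R w w w w).re) := by
      nlinarith
    exact nonneg_of_mul_nonneg_right this (by positivity)
  have hlim : Filter.Tendsto
      (fun t : ℝ => 4 * (T.R e e w w).re + t ^ 2 * (T.R w w w w).re)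
      (nhdsWithin 0 (Set.Ioi 0)) (nhds (4 * (T.R e e w w).re + 0 ^ 2 * (T.R w w w w).re)) :=
    ((by fun_prop : Continuous fun t : ℝ =>
      4 * (T.R e e w w).re + t ^ 2 * (T.R w w w w).re).tendsto 0).mono_left nhdsWithin_le_nhds
  have := ge_of_tendsto hlim (Filter.eventually_of_mem self_mem_nhdsWithin fun t ht => key t ht)
  linarith

/-- Subtracting from `T` the curvature tensor of constant holomorphic sectional curvature `m`. -/
noncomputable def subConst (T : KahlerCurvatureTensor E) (m : ℝ) : KahlerCurvatureTensor E where
  R X Y Z W := T.R X Y Z W - m / 2 * (⟪Y, X⟫_ℂ * ⟪W, Z⟫_ℂ + ⟪W, X⟫_ℂ * ⟪Y, Z⟫_ℂ)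
  add_fst _ _ _ _ _ := by rw [T.add_fst]; simp only [inner_add_right]; ring
  smul_fst _ _ _ _ _ := by rw [T.smul_fst]; simp only [inner_smul_right]; ring
  add_snd _ _ _ _ _ := by rw [T.add_snd]; simp only [inner_add_left]; ring
  smul_snd _ _ _ _ _ := by rw [T.smul_snd]; simp only [inner_smul_left]; ring
  add_trd _ _ _ _ _ := by rw [T.add_trd]; simp only [inner_add_right]; ring
  smul_trd _ _ _ _ _ := by rw [T.smul_trd]; simp only [inner_smul_right]; ring
  add_fth _ _ _ _ _ := by rw [T.add_fth]; simp only [inner_add_left]; ring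
  smul_fth _ _ _ _ _ := by rw [T.smul_fth]; simp only [inner_smul_left]; ring
  sym_fst_trd X Y Z W := by rw [T.sym_fst_trd X]; ring
  sym_snd_fth X Y Z W := by rw [T.sym_snd_fth X]; ring
  conj_sym X Y Z W := by
    rw [T.conj_sym X]
    simp only [map_sub, map_mul, map_add, map_div₀, inner_conj_symm, Complex.conj_ofReal,
      map_ofNat]
    ring

theorem subConst_bisectional_re (T : KahlerCurvatureTensor E) (m : ℝ) (V W : E) :
    ((T.subConst m).R V V W W).re
      = (T.R V V W W).re - m / 2 * (‖V‖ ^ 2 * ‖W‖ ^ 2 + ‖⟪W, V⟫_ℂ‖ ^ 2) := by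
  have h : ⟪W, V⟫_ℂ * ⟪V, W⟫_ℂ = ((‖⟪W, V⟫_ℂ‖ ^ 2 : ℝ) : ℂ) := by
    rw [← inner_conj_symm V W, Complex.mul_conj, Complex.normSq_eq_norm_sq]
  have hm : (m / 2 : ℂ) * (((‖V‖ : ℂ)) ^ 2 * (‖W‖ : ℂ) ^ 2 + ((‖⟪W, V⟫_ℂ‖ ^ 2 : ℝ) : ℂ))
      = ((m / 2 * (‖V‖ ^ 2 * ‖W‖ ^ 2 + ‖⟪W, V⟫_ℂ‖ ^ 2) : ℝ) : ℂ) := by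
    push_cast; ring
  simp only [subConst]
  rw [h, inner_self_eq_norm_sq_to_K, inner_self_eq_norm_sq_to_K]
  erw [hm]
  rw [Complex.sub_re, Complex.ofReal_re]

theorem subConst_holomorphic_re (T : KahlerCurvatureTensor E) (m : ℝ) (V : E) :
    ((T.subConst m).R V V V V).re = (T.R V V V V).re - m * ‖V‖ ^ 4 := by
  have h : ‖⟪V, V⟫_ℂ‖ = ‖V‖ ^ 2 := by simp [inner_self_eq_norm_sq_to_K]
  rw [subConst_bisectional_re, h]
  ring

/-- A lower bound on unit vectors extends to all vectors by homogeneity. -/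
theorem mul_norm_pow_four_le (T : KahlerCurvatureTensor E) {m : ℝ}
    (hm : ∀ V : E, ‖V‖ = 1 → m ≤ (T.R V V V V).re) (V : E) :
    m * ‖V‖ ^ 4 ≤ (T.R V V V V).re := by
  rcases eq_or_ne V 0 with rfl | hV
  · have := T.holomorphic_re_real_smul 0 0
    simp at this
    simp [this]
  · have hpos : 0 < ‖V‖ := norm_pos_iff.2 hV
    have h := hm (((‖V‖⁻¹ : ℝ) : ℂ) • V) (by
      rw [norm_smul, Complex.norm_real, norm_inv, norm_norm, inv_mul_cancel₀ hpos.ne'])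
    rw [T.holomorphic_re_real_smul, inv_pow, inv_mul_eq_div, le_div_iff₀ (by positivity)] at h
    exact h

end KahlerCurvatureTensor

/-- Lemma 3.1 (Yang): if `e₁` is a unit vector minimizing the holomorphic
sectional curvature, then `2 R(e₁,e̅₁,W,W̅) ≥ (1 + |⟨W,e₁⟩|²) R(e₁,e̅₁,e₁,e̅₁)`
for every unit vector `W`. -/
theorem stmt_0 (E : Type*) [NormedAddCommGroup E] [InnerProductSpace ℂ E]
    [FiniteDimensional ℂ E] (R : KahlerCurvatureTensor E)
    (e₁ : E) (he₁ : ‖e₁‖ = 1)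
    (hmin : ∀ V : E, ‖V‖ = 1 → (R.R e₁ e₁ e₁ e₁).re ≤ (R.R V V V V).re) :
    ∀ W : E, ‖W‖ = 1 →
      2 * (R.R e₁ e₁ W W).re ≥
        (1 + ‖⟪W, e₁⟫_ℂ‖ ^ 2) * (R.R e₁ e₁ e₁ e₁).re := by
  intro W hW
  have h := (R.subConst (R.R e₁ e₁ e₁ e₁).re).bisectional_nonneg_of_eq_zero
    (fun V => by
      rw [R.subConst_holomorphic_re]
      exact sub_nonneg.2 (R.mul_norm_pow_four_le hmin V))
    e₁ (by rw [R.subConst_holomorphic_re, he₁]; ring) W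
  rw [R.subConst_bisectional_re, he₁, hW] at h
  linarith
end

section
/- Let E be a finite-dimensional complex inner product space and let R be a Kähler curvature-type tensor on E with nonnegative holomorphic sectional curvature. If V ∈ E is a nonzero vector such that R(V,V,W,W) = 0 for every W ∈ E, then R(V,X,Y,Z) = 0 for all X,Y,Z ∈ E, i.e. V is a truly flat vector for R. -/
open scoped ComplexConjugate InnerProductSpace

/-- An affine function on `ℝ` that is bounded below has zero slope. -/
lemma eq_zero_of_forall_add_mul_nonneg {a k : ℝ} (h : ∀ r : ℝ, 0 ≤ a + r * k) : k = 0 := by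
  by_contra hk
  have h1 := h (-(a + 1) / k)
  rw [div_mul_cancel₀ _ hk] at h1
  linarith

/-- A nonnegative real polynomial `a + 4 Re (t b) + 2 Re (t² c)` in `t : ℂ` has no linear term. -/
lemma eq_zero_of_forall_re_nonneg {a : ℝ} {b c : ℂ}
    (h : ∀ t : ℂ, 0 ≤ a + 4 * (t * b).re + 2 * (t ^ 2 * c).re) : b = 0 := by
  have hsq : ∀ t : ℂ, 0 ≤ a + 2 * (t ^ 2 * c).re := fun t => by
    have h1 := h t
    have h2 := h (-t)
    simp only [neg_sq, neg_mul, Complex.neg_re] at h2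
    linarith
  have hsq' : ∀ z : ℂ, 0 ≤ a + 2 * (z * c).re := fun z => by
    obtain ⟨t, rfl⟩ := IsAlgClosed.exists_pow_nat_eq z two_pos
    exact hsq t
  have hre : ∀ z : ℂ, (z * c).re = 0 := fun z => by
    have := eq_zero_of_forall_add_mul_nonneg (a := a) (k := 2 * (z * c).re) fun r => by
      have h1 := hsq' (r * z)
      rw [mul_assoc, Complex.re_ofReal_mul] at h1
      linarith
    linarith
  have hlin : ∀ z : ℂ, (z * b).re = 0 := fun z => by
    have := eq_zero_of_forall_add_mul_nonneg (a := a) (k := 4 * (z * b).re) fun r => by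
      have h1 := h (r * z)
      rw [hre, mul_assoc, Complex.re_ofReal_mul] at h1
      linarith
    linarith
  have h1 := hlin 1
  have h2 := hlin Complex.I
  apply Complex.ext <;> simp_all

namespace KahlerCurvatureTensor

variable {E : Type*} [NormedAddCommGroup E] [InnerProductSpace ℂ E] (R : KahlerCurvatureTensor E)

/-- Polarization in the last two arguments. -/
lemma eq_zero_of_forall_diag_right {A B : E} (h : ∀ W, R.R A B W W = 0) (X Y : E) :
    R.R A B X Y = 0 := by
  have h1 := h (X + Y)
  have h2 := h (X + Complex.I • Y)
  simp only [R.add_trd, R.add_fth, R.smul_trd, R.smul_fth, h, Complex.conj_I] at h1 h2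
  linear_combination (1 / 2) * h1 + (Complex.I / 2) * h2
    + (1 / 2) * (R.R A B X Y - R.R A B Y X) * Complex.I_sq

/-- Polarization of the last three arguments. -/
lemma eq_zero_of_forall_diag {V : E} (h : ∀ W, R.R V W W W = 0) (X Y Z : E) :
    R.R V X Y Z = 0 := by
  have hdiag : ∀ A B, R.R V A B A = 0 := fun A B => by
    have h1 := h (A + B)
    have h2 := h (A + (-1 : ℂ) • B)
    have h3 := h (A + Complex.I • B)
    have h4 := h (A + (-Complex.I) • B)
    simp only [R.add_snd, R.add_trd, R.add_fth, R.smul_snd, R.smul_trd, R.smul_fth, h,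
      Complex.conj_I, map_neg, map_one] at h1 h2 h3 h4
    linear_combination (1 / 4) * (h1 - h2) - (Complex.I / 4) * (h3 - h4)
      + (1 / 2) * (R.R V A B A - R.R V B A A - R.R V A A B) * Complex.I_sq
  have h1 := hdiag (X + Z) Y
  simp only [R.add_snd, R.add_fth, hdiag] at h1
  linear_combination (1 / 2) * h1 + (1 / 2) * R.sym_snd_fth V X Y Z

/-- If `R(V, V̅, ·, ·) = 0`, then `R(W + tV)` on the diagonal has degree at most two in `t`. -/
lemma re_diag_add_smul {V : E} (hflat : ∀ X Y, R.R V V X Y = 0) (W : E) (t : ℂ) :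
    (R.R (W + t • V) (W + t • V) (W + t • V) (W + t • V)).re =
      (R.R W W W W).re + 4 * (t * R.R V W W W).re + 2 * (t ^ 2 * R.R V W V W).re := by
  have hVfth : ∀ X Y, R.R V X Y V = 0 := fun X Y => by rw [R.sym_snd_fth, hflat]
  have hVsnd : ∀ X Y, R.R X V V Y = 0 := fun X Y => by rw [R.sym_fst_trd, hflat]
  have hVtrd : ∀ X Y, R.R X Y V V = 0 := fun X Y => by rw [R.sym_fst_trd, hVfth]
  have e1 : R.R W W V W = R.R V W W W := R.sym_fst_trd _ _ _ _
  have e2 : R.R W V W W = conj (R.R V W W W) := R.conj_sym _ _ _ _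
  have e3 : R.R W W W V = conj (R.R V W W W) := by rw [R.sym_snd_fth, e2]
  have e4 : R.R W V W V = conj (R.R V W V W) := R.conj_sym _ _ _ _
  simp only [R.add_fst, R.add_snd, R.add_trd, R.add_fth, R.smul_fst, R.smul_snd, R.smul_trd,
    R.smul_fth, hflat, hVfth, hVsnd, hVtrd, e1, e2, e3, e4]
  simp only [pow_two, Complex.add_re, Complex.mul_re, Complex.mul_im, Complex.conj_re,
    Complex.conj_im, Complex.zero_re, Complex.zero_im]
  ring

end KahlerCurvatureTensor

/-- Lemma 2.1 (Heier–Wong): if `R` has nonnegative holomorphic sectional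
curvature and `R(V,V̅,W,W̅) = 0` for every `W`, then `V` is truly flat. -/
theorem stmt_1 (E : Type*) [NormedAddCommGroup E] [InnerProductSpace ℂ E]
    [FiniteDimensional ℂ E] (R : KahlerCurvatureTensor E)
    (hH : ∀ V : E, V ≠ 0 → 0 ≤ (R.R V V V V).re / ‖V‖ ^ 4)
    (V : E) (hV : V ≠ 0)
    (hflat : ∀ W : E, R.R V V W W = 0) :
    ∀ X Y Z : E, R.R V X Y Z = 0 := by
  have hnonneg : ∀ W : E, 0 ≤ (R.R W W W W).re := fun W => by
    by_cases hW : W = 0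
    · have h0 := R.smul_fst 0 W W W W
      rw [zero_smul, zero_mul] at h0
      subst hW
      rw [h0, Complex.zero_re]
    · have hpos : 0 < ‖W‖ ^ 4 := pow_pos (norm_pos_iff.mpr hW) 4
      have h1 := mul_nonneg (hH W hW) hpos.le
      rwa [div_mul_cancel₀ _ hpos.ne'] at h1
  refine R.eq_zero_of_forall_diag fun W => ?_
  refine eq_zero_of_forall_re_nonneg (a := (R.R W W W W).re) (c := R.R V W V W) fun t => ?_
  rw [← R.re_diag_add_smul (R.eq_zero_of_forall_diag_right hflat)]
  exact hnonneg _
end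

section
/- Let E be a finite-dimensional complex inner product space and let R be a Kähler curvature-type tensor on E with nonnegative holomorphic sectional curvature. Then R has no nonzero truly flat vector if and only if R is RC-positive, i.e. for every nonzero V ∈ E there exists W ∈ E such that R(V,V,W,W) > 0. -/
open scoped ComplexConjugate InnerProductSpace

/-- A real polynomial which is nonnegative at all positive reals has nonnegative constant term. -/
theorem nonneg_of_forall_pos_cubic {a b c d : ℝ}
    (h : ∀ t : ℝ, 0 < t → 0 ≤ a + b * t + c * t ^ 2 + d * t ^ 3) : 0 ≤ a := by
  have hc : Continuous fun t : ℝ => a + b * t + c * t ^ 2 + d * t ^ 3 := by fun_prop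
  have ht := (hc.tendsto 0).mono_left (nhdsWithin_le_nhds (s := Set.Ioi 0))
  have h0 := ge_of_tendsto ht (Filter.eventually_of_mem self_mem_nhdsWithin h)
  simpa using h0

/-- If a real quartic without constant term is everywhere nonnegative, then its quadratic
coefficient is nonnegative. -/
theorem quadratic_coeff_nonneg {a b c d : ℝ}
    (h : ∀ t : ℝ, 0 ≤ a * t + b * t ^ 2 + c * t ^ 3 + d * t ^ 4) : 0 ≤ b := by
  refine nonneg_of_forall_pos_cubic (b := 0) (c := d) (d := 0) fun t ht => ?_
  have h1 := h t
  have h2 := h (-t)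
  have h3 : 0 ≤ t ^ 2 * (b + 0 * t + d * t ^ 2 + 0 * t ^ 3) := by nlinarith
  exact nonneg_of_mul_nonneg_right h3 (by positivity)

/-- If a real quartic with only linear, cubic and quartic terms is everywhere nonnegative, then
its cubic coefficient vanishes. -/
theorem cubic_coeff_eq_zero {a c d : ℝ}
    (h : ∀ t : ℝ, 0 ≤ a * t + c * t ^ 3 + d * t ^ 4) : c = 0 := by
  have key : ∀ {a c d : ℝ}, (∀ t : ℝ, 0 ≤ a * t + c * t ^ 3 + d * t ^ 4) → 0 ≤ a := by
    intro a c d h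
    refine nonneg_of_forall_pos_cubic (b := 0) (c := c) (d := d) fun t ht => ?_
    have h3 : 0 ≤ t * (a + 0 * t + c * t ^ 2 + d * t ^ 3) := by linarith [h t]
    exact nonneg_of_mul_nonneg_right h3 ht
  have hneg : ∀ t : ℝ, 0 ≤ (-a) * t + (-c) * t ^ 3 + d * t ^ 4 := fun t => by
    linarith [h (-t)]
  have ha : a = 0 := le_antisymm (by linarith [key hneg]) (key h)
  have key' : ∀ {c : ℝ}, (∀ t : ℝ, 0 ≤ c * t ^ 3 + d * t ^ 4) → 0 ≤ c := by
    intro c h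
    refine nonneg_of_forall_pos_cubic (b := d) (c := 0) (d := 0) fun t ht => ?_
    have h3 : 0 ≤ t ^ 3 * (c + d * t + 0 * t ^ 2 + 0 * t ^ 3) := by linarith [h t]
    exact nonneg_of_mul_nonneg_right h3 (by positivity)
  subst ha
  have h1 := key' (c := c) fun t => by linarith [h t]
  have h2 := key' (c := -c) fun t => by linarith [hneg t]
  linarith

namespace KahlerCurvatureTensor

variable {E : Type*} [NormedAddCommGroup E] [InnerProductSpace ℂ E]

theorem re_conj_sym (R : KahlerCurvatureTensor E) (X Y Z W : E) :
    (R.R X Y Z W).re = (R.R Y X W Z).re := by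
  rw [R.conj_sym, Complex.conj_re]

/-- Expansion of the unnormalized holomorphic sectional curvature along a real line. -/
theorem re_diag_line (R : KahlerCurvatureTensor E) (V W : E) (t : ℝ) :
    (R.R (V + (t : ℂ) • W) (V + (t : ℂ) • W) (V + (t : ℂ) • W) (V + (t : ℂ) • W)).re =
      (R.R V V V V).re + 4 * (R.R V V V W).re * t +
        (4 * (R.R V V W W).re + 2 * (R.R W V W V).re) * t ^ 2 +
        4 * (R.R W V W W).re * t ^ 3 + (R.R W W W W).re * t ^ 4 := by
  simp only [R.add_fst, R.add_snd, R.add_trd, R.add_fth, R.smul_fst, R.smul_snd, R.smul_trd,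
    R.smul_fth, Complex.conj_ofReal, Complex.add_re, Complex.re_ofReal_mul]
  rw [R.sym_snd_fth V W V V, R.sym_fst_trd W V V V, R.re_conj_sym V V W V,
    R.sym_snd_fth V W W V, R.sym_fst_trd W V V W, R.sym_snd_fth W W V V, R.sym_fst_trd W V V W,
    R.re_conj_sym V W V W, R.sym_snd_fth W W W V, R.re_conj_sym V W W W,
    R.sym_fst_trd W W V W, R.re_conj_sym V W W W]
  ring

/-- If `R(W,V,W,W) = 0` for all `W`, then `R(X,V,Y,Z) = 0` for all `X`, `Y`, `Z`. -/
theorem polarization (R : KahlerCurvatureTensor E) {V : E}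
    (h : ∀ W, R.R W V W W = 0) (X Y Z : E) : R.R X V Y Z = 0 := by
  have hd : ∀ X Z : E, R.R X V X Z = 0 := by
    intro X Z
    have e (a : ℂ) := h (X + a • Z)
    simp only [R.add_fst, R.add_trd, R.add_fth, R.smul_fst, R.smul_trd, R.smul_fth, h,
      R.sym_fst_trd Z V X] at e
    have e1 := e 1
    have e2 := e (-1)
    have e3 := e Complex.I
    have e4 := e (-Complex.I)
    simp only [map_one, map_neg, Complex.conj_I] at e1 e2 e3 e4
    linear_combination (1 / 4) * (e1 - e2) + (Complex.I / 4) * (e3 - e4) +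
      (R.R X V X Z / 2 - R.R X V Z X) * Complex.I_sq
  have e := hd (X + Y) Z
  simp only [R.add_fst, R.add_trd, hd, R.sym_fst_trd Y V X] at e
  linear_combination e / 2

/-- For nonnegative holomorphic sectional curvature, a vector `V` with `R(V,V,W,W) ≤ 0` for all
`W` is truly flat. -/
theorem truly_flat_of_nonpos (R : KahlerCurvatureTensor E)
    (hH : ∀ V : E, 0 ≤ (R.R V V V V).re) {V : E} (hV : ∀ W : E, (R.R V V W W).re ≤ 0)
    (X Y Z : E) : R.R V X Y Z = 0 := by
  have h0 : (R.R V V V V).re = 0 := le_antisymm (hV V) (hH V)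
  have hline (W : E) (t : ℝ) := (hH (V + (t : ℂ) • W)).trans_eq (R.re_diag_line V W t)
  simp only [h0, zero_add] at hline
  have hquad (W : E) := quadratic_coeff_nonneg (hline W)
  have hzero (W : E) : 4 * (R.R V V W W).re + 2 * (R.R W V W V).re = 0 := by
    have h1 := hquad W
    have h2 := hquad (Complex.I • W)
    simp only [R.smul_fst, R.smul_trd, R.smul_fth, ← mul_assoc, Complex.conj_I,
      Complex.I_mul_I, neg_mul, mul_neg, neg_neg, one_mul, Complex.neg_re] at h2
    linarith [hV W]
  have hre (W : E) : (R.R W V W W).re = 0 := by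
    have := cubic_coeff_eq_zero (fun t => by simpa [hzero W] using hline W t)
    linarith
  have hcub (W : E) : R.R W V W W = 0 := by
    refine Complex.ext (hre W) ?_
    have h := hre (Complex.I • W)
    simp only [R.smul_fst, R.smul_trd, R.smul_fth, ← mul_assoc, Complex.conj_I,
      Complex.I_mul_I, neg_mul, mul_neg, neg_neg, one_mul, Complex.I_mul_re] at h
    simpa using h
  rw [R.conj_sym, R.polarization hcub, map_zero]

end KahlerCurvatureTensor

/-- Lemma 3.3: for `R` with nonnegative holomorphic sectional curvature,
the absence of nonzero truly flat vectors is equivalent to RC-positivity. -/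
theorem stmt_2 (E : Type*) [NormedAddCommGroup E] [InnerProductSpace ℂ E]
    [FiniteDimensional ℂ E] (R : KahlerCurvatureTensor E)
    (hH : ∀ V : E, V ≠ 0 → 0 ≤ (R.R V V V V).re / ‖V‖ ^ 4) :
    (∀ V : E, (∀ X Y Z : E, R.R V X Y Z = 0) → V = 0) ↔
      (∀ V : E, V ≠ 0 → ∃ W : E, 0 < (R.R V V W W).re) := by
  have hH' (V : E) : 0 ≤ (R.R V V V V).re := by
    rcases eq_or_ne V 0 with rfl | hV
    · have h := R.smul_fst 0 0 0 0 0
      rw [zero_smul, zero_mul] at h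
      simp [h]
    · have h4 : 0 < ‖V‖ ^ 4 := pow_pos (norm_pos_iff.mpr hV) 4
      simpa [div_mul_cancel₀ _ h4.ne'] using mul_nonneg (hH V hV) h4.le
  constructor
  · intro hflat V hV
    by_contra! hW
    exact hV (hflat V (R.truly_flat_of_nonpos hH' hW))
  · intro hRC V hflat
    by_contra hV
    obtain ⟨W, hW⟩ := hRC V hV
    simp [hflat] at hW
end

section
/- Let E be a complex inner product space of finite dimension n ≥ 1, let R be a Kähler curvature-type tensor on E, and let κ be the minimum of the holomorphic sectional curvature H over the unit sphere of E (this minimum exists since H is continuous on the compact unit sphere). Then for every orthonormal basis e₁,…,eₙ of E and all nonnegative real numbers b₁,…,bₙ one has ∑_{i,k=1}^{n} b_i b_k R(e_i,e_i,e_k,e_k) ≥ (κ/2)·[(∑_{i=1}^{n} b_i)² + ∑_{i=1}^{n} b_i²]. -/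
open scoped ComplexConjugate InnerProductSpace

namespace KahlerCurvatureTensor

variable {E : Type*} [NormedAddCommGroup E] [InnerProductSpace ℂ E]

theorem swap_pairs (R : KahlerCurvatureTensor E) (X Y : E) :
    R.R X X Y Y = R.R Y Y X X := by
  rw [R.sym_fst_trd, R.sym_snd_fth]

/-- Averaging a Hermitian form `R(·, ·, W, W)` over `U ± v`, `U ± I v`. -/
theorem sum_fourth_roots_hermitian (R : KahlerCurvatureTensor E) (U v W : E) :
    R.R (U + (1 : ℂ) • v) (U + (1 : ℂ) • v) W W + R.R (U + (-1 : ℂ) • v) (U + (-1 : ℂ) • v) W W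
      + R.R (U + Complex.I • v) (U + Complex.I • v) W W
      + R.R (U + (-Complex.I) • v) (U + (-Complex.I) • v) W W
      = 4 * (R.R U U W W + R.R v v W W) := by
  simp only [R.add_fst, R.add_snd, R.smul_fst, R.smul_snd, map_neg, map_one, Complex.conj_I]
  linear_combination (-2 * R.R v v W W) * Complex.I_sq

/-- Averaging the quartic form `R(V, V, V, V)` over `V = U ± v`, `U ± I v`. -/
theorem sum_fourth_roots_quartic (R : KahlerCurvatureTensor E) (U v : E) :
    let q : ℂ → ℂ := fun δ => R.R (U + δ • v) (U + δ • v) (U + δ • v) (U + δ • v)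
    q 1 + q (-1) + q Complex.I + q (-Complex.I)
      = 4 * (R.R U U U U + 4 * R.R U U v v + R.R v v v v) := by
  simp only [R.add_fst, R.add_snd, R.add_trd, R.add_fth, R.smul_fst, R.smul_snd, R.smul_trd,
    R.smul_fth, map_neg, map_one, Complex.conj_I]
  rw [R.sym_snd_fth U v v U, R.sym_fst_trd v U U v, R.sym_fst_trd v v U U, R.sym_snd_fth U v v U]
  ring_nf
  simp only [Complex.I_sq, Complex.I_pow_four]
  ring

/-- Phase-averaged form of Royden's inequality: the quartic lower bound averaged over the phases of
pairwise orthogonal vectors `v i`, `i ∈ t`, all orthogonal to `U`. -/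
theorem le_phase_average (R : KahlerCurvatureTensor E) {κ : ℝ}
    (hκ : ∀ V : E, κ * (‖V‖ ^ 2) ^ 2 ≤ (R.R V V V V).re) {ι : Type*} {v : ι → E}
    (hv : Pairwise fun i j => ⟪v i, v j⟫_ℂ = 0) (t : Finset ι) (U : E)
    (hU : ∀ i ∈ t, ⟪U, v i⟫_ℂ = 0) :
    κ * (‖U‖ ^ 2 + ∑ i ∈ t, ‖v i‖ ^ 2) ^ 2 ≤
      (R.R U U U U).re + 4 * ∑ i ∈ t, (R.R U U (v i) (v i)).re
        + 2 * ∑ i ∈ t, ∑ k ∈ t, (R.R (v i) (v i) (v k) (v k)).re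
        - ∑ i ∈ t, (R.R (v i) (v i) (v i) (v i)).re := by
  classical
  induction t using Finset.induction_on generalizing U with
  | empty => simpa using hκ U
  | insert j t hj ih =>
    have hUj : ⟪U, v j⟫_ℂ = 0 := hU j (Finset.mem_insert_self j t)
    have key (δ : ℂ) (hδ : ‖δ‖ = 1) := by
      refine ih (U + δ • v j) fun i hi => ?_
      rw [inner_add_left, inner_smul_left, hU i (Finset.mem_insert_of_mem hi),
        hv (fun h : j = i => hj (h ▸ hi)), mul_zero, add_zero]
    have hnorm (δ : ℂ) (hδ : ‖δ‖ = 1) : ‖U + δ • v j‖ ^ 2 = ‖U‖ ^ 2 + ‖v j‖ ^ 2 := by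
      rw [sq, norm_add_sq_eq_norm_sq_add_norm_sq_of_inner_eq_zero (𝕜 := ℂ) _ _
        (by rw [inner_smul_right, hUj, mul_zero]), norm_smul, hδ]
      ring
    have h1 := key 1 (by simp)
    have h2 := key (-1) (by simp)
    have h3 := key Complex.I (by simp)
    have h4 := key (-Complex.I) (by simp)
    rw [hnorm _ (by simp)] at h1 h2 h3 h4
    have hq := congrArg Complex.re (R.sum_fourth_roots_quartic U (v j))
    have hh := Finset.sum_congr (rfl : t = t) fun i _ =>
      congrArg Complex.re (R.sum_fourth_roots_hermitian U (v j) (v i))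
    simp only [Complex.add_re, Complex.re_ofNat, Complex.im_ofNat, Complex.mul_re, zero_mul,
      sub_zero, Finset.sum_add_distrib, ← Finset.mul_sum] at hq hh
    simp only [Finset.sum_insert hj, Finset.sum_add_distrib]
    simp only [R.swap_pairs _ (v j)] at hq hh ⊢
    rw [← add_assoc]
    linarith

end KahlerCurvatureTensor

/-- Royden's inequality: with `κ` the minimum of the holomorphic sectional
curvature over the unit sphere, for every orthonormal basis `e₁,…,eₙ` and
nonnegative reals `b₁,…,bₙ` one has
`∑ᵢₖ bᵢ bₖ R(eᵢ,e̅ᵢ,eₖ,e̅ₖ) ≥ (κ/2)[(∑ᵢ bᵢ)² + ∑ᵢ bᵢ²]`. -/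
theorem stmt_3 (E : Type*) [NormedAddCommGroup E] [InnerProductSpace ℂ E]
    [FiniteDimensional ℂ E] (n : ℕ) (hn : 1 ≤ n)
    (hdim : Module.finrank ℂ E = n)
    (R : KahlerCurvatureTensor E) (κ : ℝ)
    (hκ_le : ∀ V : E, ‖V‖ = 1 → κ ≤ (R.R V V V V).re)
    (hκ_mem : ∃ V : E, ‖V‖ = 1 ∧ κ = (R.R V V V V).re)
    (e : Fin n → E) (he : Orthonormal ℂ e)
    (b : Fin n → ℝ) (hb : ∀ i, 0 ≤ b i) :
    ∑ i, ∑ k, b i * b k * (R.R (e i) (e i) (e k) (e k)).re ≥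
      κ / 2 * ((∑ i, b i) ^ 2 + ∑ i, (b i) ^ 2) := by
  have hκ (V : E) : κ * (‖V‖ ^ 2) ^ 2 ≤ (R.R V V V V).re := by
    rcases eq_or_ne V 0 with rfl | hV
    · have h := R.smul_fst 0 (0 : E) 0 0 0
      rw [zero_smul, zero_mul] at h
      simp [h]
    · have hV' : ‖V‖ ≠ 0 := norm_ne_zero_iff.mpr hV
      have h := hκ_le (((‖V‖⁻¹ : ℝ) : ℂ) • V) (by
        rw [norm_smul, Complex.norm_real, norm_inv, norm_norm, inv_mul_cancel₀ hV'])
      simp only [R.smul_fst, R.smul_snd, R.smul_trd, R.smul_fth, Complex.conj_ofReal,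
        Complex.re_ofReal_mul] at h
      calc κ * (‖V‖ ^ 2) ^ 2
          ≤ ‖V‖⁻¹ * (‖V‖⁻¹ * (‖V‖⁻¹ * (‖V‖⁻¹ * (R.R V V V V).re))) * (‖V‖ ^ 2) ^ 2 := by gcongr
        _ = (R.R V V V V).re := by field_simp
  let v : Fin n → E := fun i => ((√(b i) : ℝ) : ℂ) • e i
  have hv : Pairwise fun i j => ⟪v i, v j⟫_ℂ = 0 := fun i j hij => by
    simp [v, he.2 hij]
  have hvn (i : Fin n) : ‖v i‖ ^ 2 = b i := by
    rw [norm_smul, he.1, mul_one, Complex.norm_real, Real.norm_eq_abs, sq_abs, Real.sq_sqrt (hb i)]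
  have hvR (i k : Fin n) : (R.R (v i) (v i) (v k) (v k)).re =
      b i * b k * (R.R (e i) (e i) (e k) (e k)).re := by
    simp only [v, R.smul_fst, R.smul_snd, R.smul_trd, R.smul_fth, Complex.conj_ofReal,
      Complex.re_ofReal_mul]
    linear_combination (R.R (e i) (e i) (e k) (e k)).re *
      (√(b k) ^ 2 * Real.sq_sqrt (hb i) + b i * Real.sq_sqrt (hb k))
  have hzero (W : E) : R.R 0 0 W W = 0 := by
    simpa using R.smul_fst 0 (0 : E) 0 W W
  have havg := R.le_phase_average hκ hv Finset.univ 0 fun i _ => inner_zero_left _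
  simp only [hvn, hvR, hzero, norm_zero, Complex.zero_re, Finset.sum_const_zero] at havg
  have hdiag : κ * ∑ i, b i ^ 2 ≤ ∑ i, b i * b i * (R.R (e i) (e i) (e i) (e i)).re := by
    rw [Finset.mul_sum]
    refine Finset.sum_le_sum fun i _ => ?_
    nlinarith [mul_le_mul_of_nonneg_left (hκ_le (e i) (he.1 i)) (mul_self_nonneg (b i))]
  rw [zero_pow two_ne_zero, zero_add] at havg
  linarith
end

section
/- Let E be a finite-dimensional complex inner product space and let R be a Kähler curvature-type tensor on E with nonnegative holomorphic sectional curvature. If V ∈ E is a nonzero vector with R(V,V,V,V) = 0, then R(V,V,W,W) ≥ 0 for every W ∈ E. -/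
open scoped ComplexConjugate InnerProductSpace

namespace KahlerCurvatureTensor

variable {E : Type*} [NormedAddCommGroup E] [InnerProductSpace ℂ E]

/-- Averaging `X ↦ R(X,X̅,X,X̅)` over the four points `V + cW`, `c ∈ {t, -t, it, -it}`, removes
all terms not invariant under multiplication of `W` by fourth roots of unity. -/
theorem sum_fourth_roots_s4 (R : KahlerCurvatureTensor E) (V W : E) (t : ℝ) :
    let Q : E → ℂ := fun X => R.R X X X X
    Q (V + (t : ℂ) • W) + Q (V + (-t : ℂ) • W) + Q (V + (t * Complex.I : ℂ) • W)
      + Q (V + (-(t * Complex.I) : ℂ) • W)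
      = 4 * Q V + 16 * (t : ℂ) ^ 2 * R.R V V W W + 4 * (t : ℂ) ^ 4 * Q W := by
  have h₁ : R.R W V V W = R.R V V W W := R.sym_fst_trd _ _ _ _
  have h₂ : R.R V W W V = R.R V V W W := R.sym_snd_fth _ _ _ _
  have h₃ : R.R W W V V = R.R V V W W := by rw [R.sym_fst_trd, h₂]
  simp only [R.add_fst, R.add_snd, R.add_trd, R.add_fth, R.smul_fst, R.smul_snd, R.smul_trd,
    R.smul_fth, h₁, h₂, h₃, map_neg, map_mul, Complex.conj_ofReal, Complex.conj_I]
  have hI : Complex.I ^ 2 = -1 := Complex.I_sq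
  have hI4 : Complex.I ^ 4 = 1 := Complex.I_pow_four
  ring_nf
  simp only [hI, hI4]
  ring

end KahlerCurvatureTensor

/-- If `R` has nonnegative holomorphic sectional curvature and `V ≠ 0`
satisfies `R(V,V̅,V,V̅) = 0`, then `R(V,V̅,W,W̅) ≥ 0` for every `W`. -/
theorem stmt_4 (E : Type*) [NormedAddCommGroup E] [InnerProductSpace ℂ E]
    [FiniteDimensional ℂ E] (R : KahlerCurvatureTensor E)
    (hH : ∀ V : E, V ≠ 0 → 0 ≤ (R.R V V V V).re / ‖V‖ ^ 4)
    (V : E) (hV : V ≠ 0) (hzero : R.R V V V V = 0) :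
    ∀ W : E, 0 ≤ (R.R V V W W).re := by
  intro W
  have hQ : ∀ X : E, 0 ≤ (R.R X X X X).re := by
    intro X
    by_cases hX : X = 0
    · have h := R.smul_fst 0 X X X X
      rw [zero_smul, zero_mul] at h
      rw [hX] at h ⊢
      simp [h]
    · have hpos : 0 < ‖X‖ ^ 4 := by positivity
      have h := hH X hX
      rwa [le_div_iff₀ hpos, zero_mul] at h
  have key : ∀ t : ℝ, 0 ≤ 16 * t ^ 2 * (R.R V V W W).re + 4 * t ^ 4 * (R.R W W W W).re := by
    intro t
    have h := congrArg Complex.re (R.sum_fourth_roots_s4 V W t)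
    have e : (4 * R.R V V V V + 16 * (t : ℂ) ^ 2 * R.R V V W W
        + 4 * (t : ℂ) ^ 4 * R.R W W W W).re
        = 16 * t ^ 2 * (R.R V V W W).re + 4 * t ^ 4 * (R.R W W W W).re := by
      have e₁ : (16 * (t : ℂ) ^ 2) = ((16 * t ^ 2 : ℝ) : ℂ) := by push_cast; rfl
      have e₂ : (4 * (t : ℂ) ^ 4) = ((4 * t ^ 4 : ℝ) : ℂ) := by push_cast; rfl
      rw [hzero, mul_zero, zero_add, e₁, e₂, Complex.add_re, Complex.re_ofReal_mul,
        Complex.re_ofReal_mul]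
    rw [← e, ← h]
    simp only [Complex.add_re]
    exact add_nonneg (add_nonneg (add_nonneg (hQ _) (hQ _)) (hQ _)) (hQ _)
  by_contra! hA
  set A := (R.R V V W W).re
  set D := (R.R W W W W).re
  have hD : 0 ≤ D := hQ W
  have hs : 0 < -A / (D + 1) := div_pos (by linarith) (by linarith)
  have h := key (√(-A / (D + 1)))
  have hsq : √(-A / (D + 1)) ^ 2 = -A / (D + 1) := Real.sq_sqrt hs.le
  rw [show √(-A / (D + 1)) ^ 4 = (√(-A / (D + 1)) ^ 2) ^ 2 by ring, hsq] at h
  have hm : -A / (D + 1) * (D + 1) = -A := div_mul_cancel₀ _ (by linarith)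
  set s := -A / (D + 1)
  nlinarith [mul_pos hs hs, mul_pos hs (neg_pos.mpr hA)]
end

section
/- Let E be a finite-dimensional complex inner product space and let R be a Kähler curvature-type tensor on E with nonnegative holomorphic sectional curvature. If V ∈ E is a nonzero vector such that R(V,V,W,W) ≤ 0 for every W ∈ E, then V is truly flat for R, i.e. R(V,X,Y,Z) = 0 for all X,Y,Z ∈ E. -/
open scoped ComplexConjugate InnerProductSpace

lemma nonneg_of_forall_pos_mul_nonneg {g : ℝ → ℝ} (hg : Continuous g)
    (h : ∀ s : ℝ, 0 < s → 0 ≤ s * g s) : 0 ≤ g 0 := by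
  have ht : Filter.Tendsto g (nhdsWithin 0 (Set.Ioi 0)) (nhds (g 0)) :=
    hg.continuousAt.tendsto.mono_left nhdsWithin_le_nhds
  refine ge_of_tendsto ht ?_
  filter_upwards [self_mem_nhdsWithin] with s hs
  exact nonneg_of_mul_nonneg_right (h s hs) hs

/-- If a real quartic without constant term is nonnegative, its linear coefficient vanishes, its
quadratic coefficient is nonnegative, and its cubic coefficient vanishes as soon as the quadratic
one does. -/
lemma quartic_coeff_of_nonneg {a b c d : ℝ}
    (h : ∀ s : ℝ, 0 ≤ a * s + b * s ^ 2 + c * s ^ 3 + d * s ^ 4) :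
    a = 0 ∧ 0 ≤ b ∧ (b = 0 → c = 0) := by
  have ha : a = 0 := by
    have h1 := nonneg_of_forall_pos_mul_nonneg
      (g := fun s ↦ a + b * s + c * s ^ 2 + d * s ^ 3) (by fun_prop)
      (fun s _ ↦ by linear_combination h s)
    have h2 := nonneg_of_forall_pos_mul_nonneg
      (g := fun s ↦ -a + b * s - c * s ^ 2 + d * s ^ 3) (by fun_prop)
      (fun s _ ↦ by linear_combination h (-s))
    norm_num at h1 h2
    linarith
  subst ha
  refine ⟨rfl, ?_, ?_⟩
  · have h1 := nonneg_of_forall_pos_mul_nonneg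
      (g := fun s ↦ b + c * s + d * s ^ 2) (by fun_prop)
      (fun s hs ↦ nonneg_of_mul_nonneg_right (a := s) (by linear_combination h s) hs)
    simpa using h1
  · rintro rfl
    have h1 := nonneg_of_forall_pos_mul_nonneg
      (g := fun s ↦ c + d * s) (by fun_prop)
      (fun s hs ↦ nonneg_of_mul_nonneg_right (a := s ^ 2)
        (by linear_combination h s) (by positivity))
    have h2 := nonneg_of_forall_pos_mul_nonneg
      (g := fun s ↦ -c + d * s) (by fun_prop)
      (fun s hs ↦ nonneg_of_mul_nonneg_right (a := s ^ 2)
        (by linear_combination h (-s)) (by positivity))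
    norm_num at h1 h2
    linarith

namespace KahlerCurvatureTensor

variable {E : Type*} [NormedAddCommGroup E] [InnerProductSpace ℂ E]

lemma re_apply_add_smul (R : KahlerCurvatureTensor E) (V W : E) (s : ℝ) :
    (R.R (V + (s : ℂ) • W) (V + (s : ℂ) • W) (V + (s : ℂ) • W) (V + (s : ℂ) • W)).re =
      (R.R V V V V).re + (4 * (R.R V V V W).re) * s
        + (4 * (R.R V V W W).re + 2 * (R.R V W V W).re) * s ^ 2
        + (4 * (R.R V W W W).re) * s ^ 3 + (R.R W W W W).re * s ^ 4 := by
  have e1 : R.R V W V V = R.R V V V W := R.sym_snd_fth ..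
  have e2 : R.R W V V V = conj (R.R V V V W) := by rw [R.conj_sym, e1]
  have e3 : R.R V V W V = conj (R.R V V V W) := by rw [R.sym_fst_trd, e2]
  have e4 : R.R W V V W = R.R V V W W := R.sym_fst_trd ..
  have e5 : R.R W W V V = R.R V V W W := by rw [R.sym_snd_fth, e4]
  have e6 : R.R V W W V = R.R V V W W := R.sym_snd_fth ..
  have e7 : R.R W V W V = conj (R.R V W V W) := R.conj_sym ..
  have e8 : R.R W W V W = R.R V W W W := R.sym_fst_trd ..
  have e9 : R.R W V W W = conj (R.R V W W W) := R.conj_sym ..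
  have e10 : R.R W W W V = conj (R.R V W W W) := by rw [R.sym_snd_fth, e9]
  simp only [R.add_fst, R.add_snd, R.add_trd, R.add_fth, R.smul_fst, R.smul_snd, R.smul_trd,
    R.smul_fth, e1, e2, e3, e4, e5, e6, e7, e8, e9, e10, Complex.conj_ofReal, Complex.add_re,
    Complex.re_ofReal_mul, Complex.conj_re]
  ring

lemma apply_eq_zero_of_cubic_eq_zero (R : KahlerCurvatureTensor E) {V : E}
    (h : ∀ W, R.R V W W W = 0) (X Y Z : E) : R.R V X Y Z = 0 := by
  have key : ∀ X Y : E, R.R V X Y X = 0 := by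
    intro X Y
    have h1 := h (Y + (1 : ℂ) • X)
    have h2 := h (Y + (-1 : ℂ) • X)
    have h3 := h (Y + Complex.I • X)
    have h4 := h (Y + (-Complex.I) • X)
    simp only [R.add_snd, R.add_trd, R.add_fth, R.smul_snd, R.smul_trd, R.smul_fth, h, map_neg,
      map_one, Complex.conj_I] at h1 h2 h3 h4
    linear_combination (1 / 4 : ℂ) * (h1 + h2 - h3 - h4)
      + (R.R V X Y X - R.R V X X Y - R.R V Y X X) / 2 * Complex.I_sq
  have h1 := key (X + Z) Y
  simp only [R.add_snd, R.add_fth, key] at h1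
  rw [R.sym_snd_fth V Z Y X] at h1
  linear_combination h1 / 2

end KahlerCurvatureTensor

/-- If `R` has nonnegative holomorphic sectional curvature and `V ≠ 0`
satisfies `R(V,V̅,W,W̅) ≤ 0` for every `W`, then `V` is truly flat. -/
theorem stmt_5 (E : Type*) [NormedAddCommGroup E] [InnerProductSpace ℂ E]
    [FiniteDimensional ℂ E] (R : KahlerCurvatureTensor E)
    (hH : ∀ V : E, V ≠ 0 → 0 ≤ (R.R V V V V).re / ‖V‖ ^ 4)
    (V : E) (hV : V ≠ 0)
    (hnonpos : ∀ W : E, (R.R V V W W).re ≤ 0) :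
    ∀ X Y Z : E, R.R V X Y Z = 0 := by
  have hpos : ∀ U : E, 0 ≤ (R.R U U U U).re := by
    intro U
    rcases eq_or_ne U 0 with rfl | hU
    · have h0 := R.smul_fst 0 0 0 0 0
      rw [zero_smul, zero_mul] at h0
      simp [h0]
    · have hn : 0 < ‖U‖ ^ 4 := by positivity
      have := mul_nonneg (hH U hU) hn.le
      rwa [div_mul_cancel₀ _ hn.ne'] at this
  have hVV : (R.R V V V V).re = 0 := le_antisymm (hnonpos V) (hpos V)
  have coeffs : ∀ W : E, 0 ≤ 4 * (R.R V V W W).re + 2 * (R.R V W V W).re ∧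
      (4 * (R.R V V W W).re + 2 * (R.R V W V W).re = 0 → 4 * (R.R V W W W).re = 0) := by
    intro W
    refine (quartic_coeff_of_nonneg (a := 4 * (R.R V V V W).re) (d := (R.R W W W W).re)
      fun s ↦ ?_).2
    have h := hpos (V + (s : ℂ) • W)
    rw [R.re_apply_add_smul, hVV] at h
    linarith
  have hre : ∀ W : E, (R.R V W W W).re = 0 := by
    intro W
    have h1 := coeffs W
    have h2 := (coeffs (Complex.I • W)).1
    have e1 : (R.R V V (Complex.I • W) (Complex.I • W)).re = (R.R V V W W).re := by
      simp [R.smul_trd, R.smul_fth]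
    have e2 : (R.R V (Complex.I • W) V (Complex.I • W)).re = -(R.R V W V W).re := by
      simp [R.smul_snd, R.smul_fth]
    rw [e1, e2] at h2
    have h3 := hnonpos W
    linarith [h1.1, h1.2 (by linarith [h1.1])]
  refine R.apply_eq_zero_of_cubic_eq_zero fun W ↦ Complex.ext (hre W) ?_
  have h := hre (Complex.I • W)
  simpa [R.smul_snd, R.smul_trd, R.smul_fth] using h
end

section
/- Let E be a finite-dimensional complex inner product space and let R be a Kähler curvature-type tensor on E with nonnegative holomorphic sectional curvature and with no nonzero truly flat vector. Then for every nonempty finite orthonormal family e₁,…,e_m of vectors in E there exists v ∈ E such that ∑_{j=1}^{m} R(v,v,e_j,e_j) > 0. -/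
open scoped ComplexConjugate InnerProductSpace

namespace KahlerCurvatureTensor

variable {E : Type*} [NormedAddCommGroup E] [InnerProductSpace ℂ E] (R : KahlerCurvatureTensor E)

/-- The diagonal quartic form `R(V,V,V,V)`. -/
def quartic (V : E) : ℝ := (R.R V V V V).re

/-- The bisectional form `R(V,V,W,W)`. -/
def bisec (V W : E) : ℝ := (R.R V V W W).re

lemma re_swap (X Y Z W : E) : (R.R X Y Z W).re = (R.R Y X W Z).re := by
  rw [R.conj_sym, Complex.conj_re]

lemma bisec_comm (V W : E) : R.bisec V W = R.bisec W V := by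
  unfold bisec
  rw [R.sym_fst_trd, R.sym_snd_fth]

lemma bisec_self (V : E) : R.bisec V V = R.quartic V := rfl

lemma quartic_add (x c : E) :
    R.quartic (x + c) = R.quartic x + 4 * (R.R c x x x).re + 4 * R.bisec c x
      + 2 * (R.R c x c x).re + 4 * (R.R c c c x).re + R.quartic c := by
  unfold quartic bisec
  simp only [R.add_fst, R.add_snd, R.add_trd, R.add_fth, Complex.add_re]
  have h1 : (R.R x c x x).re = (R.R c x x x).re := R.re_swap ..
  have h2 : R.R x x c x = R.R c x x x := R.sym_fst_trd ..
  have h3 : (R.R x x x c).re = (R.R c x x x).re := by rw [R.sym_snd_fth, h1]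
  have h4 : R.R x x c c = R.R c x x c := R.sym_fst_trd ..
  have h5 : R.R c x x c = R.R c c x x := R.sym_snd_fth ..
  have h6 : R.R x c c x = R.R c c x x := R.sym_fst_trd ..
  have h7 : (R.R x c x c).re = (R.R c x c x).re := R.re_swap ..
  have h8 : R.R c x c c = R.R c c c x := R.sym_snd_fth ..
  have h9 : (R.R x c c c).re = (R.R c c c x).re := by rw [R.re_swap, h8]
  have h10 : R.R c c x c = R.R x c c c := R.sym_fst_trd ..
  rw [h10, h9, h8, h7, h6, h4, h5, h3, h2, h1]
  ring

lemma quartic_add_smul (w v : E) (t : ℝ) :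
    R.quartic (w + (t : ℂ) • v) = R.quartic w + 4 * (R.R v w w w).re * t
      + (4 * R.bisec v w + 2 * (R.R v w v w).re) * t ^ 2
      + 4 * (R.R v v v w).re * t ^ 3 + R.quartic v * t ^ 4 := by
  rw [quartic_add]
  unfold quartic bisec
  simp only [R.smul_fst, R.smul_snd, R.smul_trd, R.smul_fth, Complex.conj_ofReal,
    Complex.re_ofReal_mul]
  ring

lemma quartic_average (x c : E) :
    R.quartic (x + c) + R.quartic (x + (-1 : ℂ) • c) + R.quartic (x + Complex.I • c)
      + R.quartic (x + (-Complex.I) • c)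
      = 4 * R.quartic x + 16 * R.bisec x c + 4 * R.quartic c := by
  rw [R.bisec_comm x c]
  simp only [quartic_add]
  unfold quartic bisec
  simp only [R.smul_fst, R.smul_snd, R.smul_trd, R.smul_fth, map_neg, map_one, Complex.conj_I,
    Complex.mul_re, Complex.mul_im, Complex.neg_re, Complex.neg_im, Complex.I_re, Complex.I_im,
    Complex.one_re, Complex.one_im]
  ring

lemma bisec_average (x c a : E) :
    R.bisec (x + c) a + R.bisec (x + (-1 : ℂ) • c) a + R.bisec (x + Complex.I • c) a
      + R.bisec (x + (-Complex.I) • c) a = 4 * R.bisec x a + 4 * R.bisec c a := by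
  unfold bisec
  simp only [R.add_fst, R.add_snd, R.smul_fst, R.smul_snd, map_neg, map_one, Complex.conj_I,
    Complex.add_re,
    Complex.mul_re, Complex.mul_im, Complex.neg_re, Complex.neg_im, Complex.I_re, Complex.I_im,
    Complex.one_re, Complex.one_im]
  ring

/-- The average of the quartic form over `x + ∑ ε_a e_a`, with independent fourth roots of unity
`ε_a`, is nonnegative. -/
lemma average_nonneg (hQ : ∀ V, 0 ≤ R.quartic V) {ι : Type*} (e : ι → E) (s : Finset ι) :
    ∀ x : E, 0 ≤ R.quartic x + 4 * ∑ a ∈ s, R.bisec x (e a)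
      + 2 * ∑ a ∈ s, ∑ b ∈ s, R.bisec (e a) (e b) - ∑ a ∈ s, R.quartic (e a) := by
  classical
  induction s using Finset.induction_on with
  | empty => intro x; simpa using hQ x
  | insert c s hc ih =>
    intro x
    have h1 := ih (x + e c)
    have h2 := ih (x + (-1 : ℂ) • e c)
    have h3 := ih (x + Complex.I • e c)
    have h4 := ih (x + (-Complex.I) • e c)
    have hq := R.quartic_average x (e c)
    have hb := Finset.sum_congr (rfl : s = s) fun a _ => R.bisec_average x (e c) (e a)
    simp only [Finset.sum_add_distrib, ← Finset.mul_sum] at hb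
    have hcomm : ∑ a ∈ s, R.bisec (e a) (e c) = ∑ a ∈ s, R.bisec (e c) (e a) :=
      Finset.sum_congr rfl fun a _ => R.bisec_comm _ _
    simp only [Finset.sum_insert hc, Finset.sum_add_distrib, hcomm, bisec_self]
    linarith

lemma quartic_eq_zero_of_sum_nonpos (hQ : ∀ V, 0 ≤ R.quartic V) {ι : Type*} [Fintype ι]
    (e : ι → E) (hS : ∀ v, ∑ j, R.bisec v (e j) ≤ 0) (j : ι) : R.quartic (e j) = 0 := by
  have h := R.average_nonneg hQ e Finset.univ 0
  have h0 : R.quartic 0 = 0 := by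
    simpa [quartic] using congrArg Complex.re (R.smul_fst 0 0 0 0 0)
  have hb (a : E) : R.bisec 0 a = 0 := by
    simpa [bisec] using congrArg Complex.re (R.smul_fst 0 0 0 a a)
  simp only [h0, hb, Finset.sum_const_zero] at h
  have h2 : ∑ a, ∑ b, R.bisec (e a) (e b) ≤ 0 := Finset.sum_nonpos fun a _ => hS (e a)
  have h3 := Finset.single_le_sum (fun a _ => hQ (e a)) (Finset.mem_univ j)
  exact le_antisymm (by linarith) (hQ _)

lemma nonneg_at_zero {f : ℝ → ℝ} (hf : Continuous f) (h : ∀ t, 0 < t → 0 ≤ f t) : 0 ≤ f 0 :=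
  ge_of_tendsto (hf.continuousWithinAt (s := Set.Ioi 0) (x := 0))
    (Filter.eventually_of_mem self_mem_nhdsWithin h)

lemma quadratic_coeff_nonneg {a b c d : ℝ}
    (h : ∀ t : ℝ, 0 ≤ a * t + b * t ^ 2 + c * t ^ 3 + d * t ^ 4) : 0 ≤ b := by
  have := nonneg_at_zero (f := fun t => b + d * t ^ 2) (by fun_prop) fun t ht => by
    have h1 := h t
    have h2 := h (-t)
    have : 0 ≤ (b + d * t ^ 2) * t ^ 2 := by nlinarith
    exact nonneg_of_mul_nonneg_left this (by positivity)
  simpa using this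

lemma linear_coeff_nonneg {a b c d : ℝ}
    (h : ∀ t : ℝ, 0 ≤ a * t + b * t ^ 2 + c * t ^ 3 + d * t ^ 4) : 0 ≤ a := by
  have := nonneg_at_zero (f := fun t => a + b * t + c * t ^ 2 + d * t ^ 3) (by fun_prop)
    fun t ht => by
      have : 0 ≤ (a + b * t + c * t ^ 2 + d * t ^ 3) * t := by linarith [h t]
      exact nonneg_of_mul_nonneg_left this ht
  simpa using this

lemma cubic_coeff_nonneg {c d : ℝ} (h : ∀ t : ℝ, 0 ≤ c * t ^ 3 + d * t ^ 4) : 0 ≤ c := by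
  have := nonneg_at_zero (f := fun t => c + d * t) (by fun_prop) fun t ht => by
    have : 0 ≤ (c + d * t) * t ^ 3 := by linarith [h t]
    exact nonneg_of_mul_nonneg_left this (by positivity)
  simpa using this

lemma hessian_nonneg (hQ : ∀ V, 0 ≤ R.quartic V) {w : E} (hw : R.quartic w = 0) (v : E) :
    0 ≤ 4 * R.bisec v w + 2 * (R.R v w v w).re := by
  refine quadratic_coeff_nonneg (a := 4 * (R.R v w w w).re) (c := 4 * (R.R v v v w).re)
    (d := R.quartic v) fun t => ?_
  have := hQ (w + (t : ℂ) • v)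
  rw [quartic_add_smul, hw] at this
  linarith

lemma abs_re_le_bisec (hQ : ∀ V, 0 ≤ R.quartic V) {w : E} (hw : R.quartic w = 0) (v : E) :
    |(R.R v w v w).re| ≤ 2 * R.bisec v w := by
  have h1 := R.hessian_nonneg hQ hw v
  have h2 := R.hessian_nonneg hQ hw (Complex.I • v)
  simp [bisec, R.smul_fst, R.smul_snd, R.smul_trd] at h1 h2
  rw [abs_le, bisec]
  constructor <;> linarith

lemma bisec_nonneg (hQ : ∀ V, 0 ≤ R.quartic V) {w : E} (hw : R.quartic w = 0) (v : E) :
    0 ≤ R.bisec v w := by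
  linarith [abs_nonneg (R.R v w v w).re, R.abs_re_le_bisec hQ hw v]

lemma cubic_re_nonneg (hQ : ∀ V, 0 ≤ R.quartic V) {w : E} (hw : ∀ v, R.bisec v w = 0) (v : E) :
    0 ≤ (R.R v v v w).re := by
  have hw0 : R.quartic w = 0 := hw w
  have hre : (R.R v w v w).re = 0 := by
    have := R.abs_re_le_bisec hQ hw0 v
    rw [hw v, mul_zero] at this
    exact abs_nonpos_iff.mp this
  have hexp (u : E) (hu : (R.R u w u w).re = 0) (t : ℝ) :
      0 ≤ 4 * (R.R u w w w).re * t + 0 * t ^ 2 + 4 * (R.R u u u w).re * t ^ 3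
        + R.quartic u * t ^ 4 := by
    have := hQ (w + (t : ℂ) • u)
    rw [quartic_add_smul, hw0, hw u, hu] at this
    linarith
  have hlin : (R.R v w w w).re = 0 := by
    have h1 := linear_coeff_nonneg (hexp v hre)
    have h2 := linear_coeff_nonneg
      (a := -(4 * (R.R v w w w).re)) (b := 0) (c := -(4 * (R.R v v v w).re)) (d := R.quartic v)
      fun t => by linarith [hexp v hre (-t)]
    linarith
  have := cubic_coeff_nonneg (c := 4 * (R.R v v v w).re) (d := R.quartic v) fun t => by
    have := hexp v hre t
    rw [hlin] at this
    linarith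
  linarith

lemma cubic_eq_zero (hQ : ∀ V, 0 ≤ R.quartic V) {w : E} (hw : ∀ v, R.bisec v w = 0) (v : E) :
    R.R v v v w = 0 := by
  have h1 := R.cubic_re_nonneg hQ hw v
  have h2 := R.cubic_re_nonneg hQ hw ((-1 : ℂ) • v)
  have h3 := R.cubic_re_nonneg hQ hw (Complex.I • v)
  have h4 := R.cubic_re_nonneg hQ hw ((-Complex.I) • v)
  simp only [R.smul_fst, R.smul_snd, R.smul_trd, map_neg, map_one, Complex.conj_I,
    Complex.mul_re, Complex.mul_im, Complex.neg_re, Complex.neg_im, Complex.I_re, Complex.I_im,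
    Complex.one_re, Complex.one_im] at h2 h3 h4
  apply Complex.ext <;> simp only [Complex.zero_re, Complex.zero_im] <;> linarith

lemma eq_zero_of_cubic_eq_zero {w : E} (h : ∀ v, R.R v v v w = 0) (x y z : E) :
    R.R x y z w = 0 := by
  have hdiag (x y : E) : R.R x y x w = 0 := by
    have h1 := h (x + y)
    have h2 := h (x + (-1 : ℂ) • y)
    have h3 := h (x + Complex.I • y)
    have h4 := h (x + (-Complex.I) • y)
    simp only [R.add_fst, R.add_snd, R.add_trd, R.smul_fst, R.smul_snd, R.smul_trd, map_neg,
      map_one, Complex.conj_I] at h1 h2 h3 h4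
    have hI := Complex.I_sq
    grind
  have hsum := hdiag (x + z) y
  rw [R.add_fst, R.add_trd, R.add_trd, hdiag x, hdiag z, R.sym_fst_trd z] at hsum
  linear_combination hsum / 2

lemma truly_flat_of_bisec_eq_zero (hQ : ∀ V, 0 ≤ R.quartic V) {w : E}
    (hw : ∀ v, R.bisec v w = 0) (X Y Z : E) : R.R w X Y Z = 0 := by
  rw [R.conj_sym, R.sym_snd_fth, R.eq_zero_of_cubic_eq_zero (R.cubic_eq_zero hQ hw), map_zero]

end KahlerCurvatureTensor

/-- Key positivity in the proof of Theorem 1.6 (3): if `R` has nonnegative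
holomorphic sectional curvature and no nonzero truly flat vector, then for
every nonempty finite orthonormal family `e₁,…,e_m` there exists `v` with
`∑ⱼ R(v,v̅,eⱼ,e̅ⱼ) > 0`. -/
theorem stmt_9 (E : Type*) [NormedAddCommGroup E] [InnerProductSpace ℂ E]
    [FiniteDimensional ℂ E] (R : KahlerCurvatureTensor E)
    (hH : ∀ V : E, V ≠ 0 → 0 ≤ (R.R V V V V).re / ‖V‖ ^ 4)
    (hflat : ∀ V : E, (∀ X Y Z : E, R.R V X Y Z = 0) → V = 0) :
    ∀ (m : ℕ), 0 < m → ∀ e : Fin m → E, Orthonormal ℂ e →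
      ∃ v : E, 0 < ∑ j, (R.R v v (e j) (e j)).re := by
  intro m hm e he
  by_contra! hS
  have hQ (V : E) : 0 ≤ R.quartic V := by
    by_cases hV : V = 0
    · subst hV
      have h := R.smul_fst 0 0 0 0 0
      simp only [zero_smul, zero_mul] at h
      simp [KahlerCurvatureTensor.quartic, h]
    · have hpos : 0 < ‖V‖ ^ 4 := by positivity
      have h := mul_nonneg (hH V hV) hpos.le
      rwa [div_mul_cancel₀ _ hpos.ne'] at h
  have hzero := R.quartic_eq_zero_of_sum_nonpos hQ e hS
  refine he.ne_zero ⟨0, hm⟩ (hflat _ (R.truly_flat_of_bisec_eq_zero hQ fun v => ?_))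
  have hnonneg (j : Fin m) : 0 ≤ R.bisec v (e j) := R.bisec_nonneg hQ (hzero j) v
  have hle := Finset.single_le_sum (fun j _ => hnonneg j) (Finset.mem_univ (⟨0, hm⟩ : Fin m))
  exact le_antisymm (hle.trans (hS v)) (hnonneg _)
end
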